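/- arXiv:2310.00473 — 3 statements merged into one kernel-verified Lean document; each statement's English description precedes it below -/
import Mathlib

section
/- Consider the saturated closed-loop system on ℝ² (Euclidean norm): Δx_{t+1} = (A − BK)(sat(Δx_t + x*) − x*), where A, B, K are 2×2 real matrices, sat(z) = z/max(‖z‖,1), and the reference x* satisfies ‖x*‖ < 1. If (A − BK)ᵀ(A − BK) − I is negative definite, then for every Δx ∈ ℝ² with Δx ≠ 0, the one-step update satisfies ‖(A − BK)(sat(Δx + x*) − x*)‖ < ‖Δx‖. That is, V(z) = ‖z‖² is a strict Lyapunov function for the saturated system. -/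
open scoped Matrix

/-- Radial projection onto the closed unit ball does not increase the distance to a point of
the ball. -/
lemma norm_inv_max_smul_sub_le {E : Type*} [NormedAddCommGroup E] [InnerProductSpace ℝ E]
    (z y : E) (hy : ‖y‖ ≤ 1) : ‖(max ‖z‖ 1)⁻¹ • z - y‖ ≤ ‖z - y‖ := by
  rcases le_total ‖z‖ 1 with hz | hz
  · simp [max_eq_right hz]
  rw [max_eq_left hz]
  have hpos : 0 < ‖z‖ := by linarith
  refine (pow_le_pow_iff_left₀ (norm_nonneg _) (norm_nonneg _) two_ne_zero).1 ?_
  have hc : ‖z‖⁻¹ * ‖z‖ = 1 := inv_mul_cancel₀ hpos.ne'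
  have hc1 : ‖z‖⁻¹ ≤ 1 := inv_le_one_of_one_le₀ hz
  have hp : inner ℝ z y ≤ ‖z‖ :=
    (real_inner_le_norm z y).trans (mul_le_of_le_one_right hpos.le hy)
  rw [norm_sub_sq_real, norm_sub_sq_real, norm_smul, norm_inv, norm_norm, hc,
    real_inner_smul_left]
  nlinarith [mul_nonneg (sub_nonneg.2 hc1) (sub_nonneg.2 hp), sq_nonneg (‖z‖ - 1)]

/-- If `Mᵀ M - I` is negative definite, then `M` strictly decreases the Euclidean norm of
every nonzero vector. -/
lemma norm_toEuclideanLin_lt {n : Type*} [Fintype n] [DecidableEq n] (M : Matrix n n ℝ)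
    (hM : ∀ z : n → ℝ, z ≠ 0 → z ⬝ᵥ ((Mᵀ * M - 1).mulVec z) < 0)
    (w : EuclideanSpace ℝ n) (hw : w ≠ 0) : ‖Matrix.toEuclideanLin M w‖ < ‖w‖ := by
  have h := hM w.ofLp (by simpa using hw)
  rw [Matrix.sub_mulVec, Matrix.one_mulVec, dotProduct_sub, ← Matrix.mulVec_mulVec,
    Matrix.dotProduct_mulVec, Matrix.vecMul_transpose, sub_neg] at h
  refine lt_of_pow_lt_pow_left₀ 2 (norm_nonneg _) ?_
  rw [EuclideanSpace.real_norm_sq_eq, EuclideanSpace.real_norm_sq_eq]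
  simpa [dotProduct, pow_two] using h

/-- One-step strict Lyapunov decrease for the saturated closed-loop system
`Δx ↦ (A - B K) (sat (Δx + x*) - x*)` on Euclidean ℝ², assuming `‖x*‖ < 1` and
`(A - B K)ᵀ (A - B K) - I ≺ 0`. -/
theorem saturated_closed_loop_one_step_contraction
    (A B K : Matrix (Fin 2) (Fin 2) ℝ)
    (xstar : EuclideanSpace ℝ (Fin 2)) (hxstar : ‖xstar‖ < 1)
    (sat : EuclideanSpace ℝ (Fin 2) → EuclideanSpace ℝ (Fin 2))
    (hsat : ∀ z, sat z = (max ‖z‖ 1)⁻¹ • z)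
    (hK : ∀ z : Fin 2 → ℝ, z ≠ 0 →
      z ⬝ᵥ (((A - B * K)ᵀ * (A - B * K) - 1).mulVec z) < 0)
    (Δx : EuclideanSpace ℝ (Fin 2)) (hΔx : Δx ≠ 0) :
    ‖Matrix.toEuclideanLin (A - B * K) (sat (Δx + xstar) - xstar)‖ < ‖Δx‖ := by
  have hle : ‖sat (Δx + xstar) - xstar‖ ≤ ‖Δx‖ := by
    simpa [hsat] using norm_inv_max_smul_sub_le (Δx + xstar) xstar hxstar.le
  by_cases hw : sat (Δx + xstar) - xstar = 0
  · simpa [hw] using hΔx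
  · exact (norm_toEuclideanLin_lt _ hK _ hw).trans_le hle
end

section
/- Consider the saturated closed-loop system on ℝ² (Euclidean norm): Δx_{t+1} = (A − BK)(sat(Δx_t + x*) − x*), where A, B, K are 2×2 real matrices, sat(z) = z/max(‖z‖,1), and ‖x*‖ < 1. Suppose (A − BK)ᵀ(A − BK) − I is negative definite, and let γ = sup{‖(A − BK)z‖ : ‖z‖ ≤ 1} be the operator norm of A − BK, so that γ < 1. Then for every initial condition Δx₀ and every t ≥ 0, ‖Δx_t‖ ≤ γᵗ ‖Δx₀‖. -/
open scoped Matrix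

/-- Radial projection onto the unit ball does not increase the distance to a point of the ball. -/
theorem norm_radial_projection_sub_le {E : Type*} [NormedAddCommGroup E] [InnerProductSpace ℝ E]
    (z x : E) (hx : ‖x‖ ≤ 1) : ‖(max ‖z‖ 1)⁻¹ • z - x‖ ≤ ‖z - x‖ := by
  rcases le_total ‖z‖ 1 with hz | hz
  · simp [max_eq_right hz]
  rw [max_eq_left hz]
  have hpos : 0 < ‖z‖ := by linarith
  have hunit : ‖‖z‖⁻¹ • z‖ = 1 := by
    rw [norm_smul, norm_inv, norm_norm, inv_mul_cancel₀ hpos.ne']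
  have hinner : inner ℝ (‖z‖⁻¹ • z) x ≤ 1 := by
    refine (real_inner_le_norm _ _).trans ?_
    rw [hunit, one_mul]
    exact hx
  have hscale : inner ℝ z x = ‖z‖ * inner ℝ (‖z‖⁻¹ • z) x := by
    rw [real_inner_smul_left, mul_inv_cancel_left₀ hpos.ne']
  refine le_of_sq_le_sq ?_ (norm_nonneg _)
  rw [norm_sub_sq_real, norm_sub_sq_real, hunit, hscale]
  nlinarith [mul_nonneg (sub_nonneg.2 hz) (sub_nonneg.2 hinner), sq_nonneg (‖z‖ - 1)]

/-- Negative definiteness of `Mᵀ M - I` makes `M` strictly norm-decreasing on nonzero vectors. -/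
theorem norm_toEuclideanLin_lt_of_neg_def {n : Type*} [Fintype n] [DecidableEq n]
    (M : Matrix n n ℝ) (hM : ∀ z : n → ℝ, z ≠ 0 → z ⬝ᵥ ((Mᵀ * M - 1).mulVec z) < 0)
    (z : EuclideanSpace ℝ n) (hz : z ≠ 0) : ‖Matrix.toEuclideanLin M z‖ < ‖z‖ := by
  have key := hM z.ofLp (by simpa using hz)
  rw [Matrix.sub_mulVec, dotProduct_sub, ← Matrix.mulVec_mulVec, Matrix.dotProduct_mulVec,
    Matrix.vecMul_transpose, Matrix.one_mulVec] at key
  refine lt_of_pow_lt_pow_left₀ 2 (norm_nonneg _) ?_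
  rw [EuclideanSpace.real_norm_sq_eq, EuclideanSpace.real_norm_sq_eq]
  simpa [dotProduct, sq, Matrix.toLpLin_apply] using key

/-- A bound for a linear map on the closed unit ball is a Lipschitz bound. -/
theorem norm_map_le_of_unit_ball_bound {E F : Type*} [NormedAddCommGroup E] [NormedSpace ℝ E]
    [NormedAddCommGroup F] [NormedSpace ℝ F] (f : E →ₗ[ℝ] F) (γ : ℝ)
    (hf : ∀ z, ‖z‖ ≤ 1 → ‖f z‖ ≤ γ) (z : E) : ‖f z‖ ≤ γ * ‖z‖ := by
  rcases eq_or_ne z 0 with rfl | hz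
  · simp
  have hpos : 0 < ‖z‖ := norm_pos_iff.2 hz
  have h := hf (‖z‖⁻¹ • z) (by
    rw [norm_smul, norm_inv, norm_norm, inv_mul_cancel₀ hpos.ne'])
  rw [map_smul, norm_smul, norm_inv, norm_norm, inv_mul_le_iff₀ hpos] at h
  linarith

/-- Geometric decay (rate of Theorem 1): with `γ = sup {‖(A - B K) z‖ : ‖z‖ ≤ 1}` the
operator norm of the closed-loop matrix, negative definiteness of
`(A - B K)ᵀ (A - B K) - I` gives `γ < 1` and `‖Δx_t‖ ≤ γ ^ t * ‖Δx₀‖` for the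
saturated closed-loop system. -/
theorem saturated_closed_loop_geometric_decay
    (A B K : Matrix (Fin 2) (Fin 2) ℝ)
    (xstar : EuclideanSpace ℝ (Fin 2)) (hxstar : ‖xstar‖ < 1)
    (sat : EuclideanSpace ℝ (Fin 2) → EuclideanSpace ℝ (Fin 2))
    (hsat : ∀ z, sat z = (max ‖z‖ 1)⁻¹ • z)
    (hK : ∀ z : Fin 2 → ℝ, z ≠ 0 →
      z ⬝ᵥ (((A - B * K)ᵀ * (A - B * K) - 1).mulVec z) < 0)
    (γ : ℝ)
    (hγ : IsLUB {r : ℝ | ∃ z : EuclideanSpace ℝ (Fin 2), ‖z‖ ≤ 1 ∧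
      r = ‖Matrix.toEuclideanLin (A - B * K) z‖} γ)
    (Δx : ℕ → EuclideanSpace ℝ (Fin 2))
    (hstep : ∀ t : ℕ,
      Δx (t + 1) = Matrix.toEuclideanLin (A - B * K) (sat (Δx t + xstar) - xstar)) :
    γ < 1 ∧ ∀ t : ℕ, ‖Δx t‖ ≤ γ ^ t * ‖Δx 0‖ := by
  have hbound : ∀ z : EuclideanSpace ℝ (Fin 2), ‖z‖ ≤ 1 →
      ‖Matrix.toEuclideanLin (A - B * K) z‖ ≤ γ := fun z hz => hγ.1 ⟨z, hz, rfl⟩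
  have hγ_nonneg : 0 ≤ γ := (norm_nonneg _).trans (hbound 0 (by simp))
  constructor
  · obtain ⟨w, hw, hmax⟩ := (isCompact_closedBall (0 : EuclideanSpace ℝ (Fin 2)) 1).exists_isMaxOn
      ⟨0, by simp⟩
      (Matrix.toEuclideanLin (A - B * K)).continuous_of_finiteDimensional.norm.continuousOn
    have hle : γ ≤ ‖Matrix.toEuclideanLin (A - B * K) w‖ := by
      refine hγ.2 ?_
      rintro r ⟨z, hz, rfl⟩
      exact hmax (mem_closedBall_zero_iff.2 hz)
    refine hle.trans_lt ?_
    rcases eq_or_ne w 0 with rfl | hw0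
    · simp
    · exact (norm_toEuclideanLin_lt_of_neg_def _ hK w hw0).trans_le (mem_closedBall_zero_iff.1 hw)
  · intro t
    induction t with
    | zero => simp
    | succ t ih =>
      have hsat_le : ‖sat (Δx t + xstar) - xstar‖ ≤ ‖Δx t‖ := by
        simpa [hsat] using norm_radial_projection_sub_le (Δx t + xstar) xstar hxstar.le
      calc ‖Δx (t + 1)‖ ≤ γ * ‖sat (Δx t + xstar) - xstar‖ := by
            rw [hstep]
            exact norm_map_le_of_unit_ball_bound _ γ hbound _
        _ ≤ γ * (γ ^ t * ‖Δx 0‖) := by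
            gcongr
            exact hsat_le.trans ih
        _ = γ ^ (t + 1) * ‖Δx 0‖ := by ring
end

section
/- Fix real numbers L > 0, E, ω, a 2×2 real matrix K, and define Â(R) = [[R/L, ω], [−ω, R/L]] and B̂ = [[√2/L, 0], [0, √2·E/L]]. Suppose K satisfies the continuous-time stability LMI at resistance R₁, i.e., Â(R₁)ᵀ + Kᵀ·B̂ᵀ + Â(R₁) + B̂·K is positive definite. Then for every R₂ ≥ R₁ there exists Δt₀ > 0 such that for all 0 < Δt ≤ Δt₀, the forward-Euler closed-loop matrix A − B·K with A = I − Δt·Â(R₂) and B = Δt·B̂ satisfies the discrete-time stability condition (A − B·K)ᵀ(A − B·K) − I ≺ 0 (negative definite). -/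
open scoped Matrix

/-- The quadratic form of `(1 - t M)ᵀ (1 - t M) - 1`, expanded in powers of `t`. -/
lemma dotProduct_one_sub_smul_gram_sub_one {n : Type*} [Fintype n] [DecidableEq n]
    (M : Matrix n n ℝ) (t : ℝ) (z : n → ℝ) :
    z ⬝ᵥ (((1 - t • M)ᵀ * (1 - t • M) - 1) *ᵥ z) =
      t * (t * ((M *ᵥ z) ⬝ᵥ (M *ᵥ z)) - z ⬝ᵥ ((Mᵀ + M) *ᵥ z)) := by
  have h : (1 - t • M)ᵀ * (1 - t • M) - 1 = t • (t • (Mᵀ * M) - (Mᵀ + M)) := by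
    simp only [Matrix.transpose_sub, Matrix.transpose_one, Matrix.transpose_smul, sub_mul,
      mul_sub, one_mul, mul_one, Matrix.smul_mul, Matrix.mul_smul, smul_sub, smul_add]
    abel
  rw [h, Matrix.smul_mulVec, Matrix.sub_mulVec, Matrix.smul_mulVec, dotProduct_smul,
    dotProduct_sub, dotProduct_smul, ← Matrix.mulVec_mulVec, Matrix.dotProduct_mulVec z Mᵀ,
    Matrix.vecMul_transpose, smul_eq_mul, smul_eq_mul]

/-- On a finite-dimensional space, `‖M z‖²` is bounded by a multiple of a positive definite
quadratic form. -/
lemma exists_dotProduct_self_mulVec_le {n : Type*} [Fintype n] (M S : Matrix n n ℝ)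
    (hS : ∀ z : n → ℝ, z ≠ 0 → 0 < z ⬝ᵥ (S *ᵥ z)) :
    ∃ C : ℝ, 0 ≤ C ∧ ∀ z : n → ℝ, (M *ᵥ z) ⬝ᵥ (M *ᵥ z) ≤ C * (z ⬝ᵥ (S *ᵥ z)) := by
  have hne : ∀ z ∈ Metric.sphere (0 : n → ℝ) 1, z ≠ 0 := fun z hz =>
    ne_zero_of_mem_unit_sphere ⟨z, hz⟩
  obtain ⟨C, hC⟩ := (isCompact_sphere (0 : n → ℝ) 1).exists_bound_of_continuousOn
    (f := fun z => ((M *ᵥ z) ⬝ᵥ (M *ᵥ z)) / (z ⬝ᵥ (S *ᵥ z)))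
    (ContinuousOn.div (by fun_prop) (by fun_prop) fun z hz => (hS z (hne z hz)).ne')
  refine ⟨|C|, abs_nonneg C, fun z => ?_⟩
  obtain rfl | hz := eq_or_ne z 0
  · simp
  have hz' : ‖z‖ ≠ 0 := norm_ne_zero_iff.mpr hz
  have hw : ‖z‖⁻¹ • z ∈ Metric.sphere (0 : n → ℝ) 1 := by
    simp [norm_smul, hz']
  have h := (le_abs_self _).trans ((hC _ hw).trans (le_abs_self C))
  simp only [Matrix.mulVec_smul, smul_dotProduct, dotProduct_smul, smul_eq_mul] at h
  rw [mul_div_mul_left _ _ (inv_ne_zero hz'), mul_div_mul_left _ _ (inv_ne_zero hz')] at h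
  exact (div_le_iff₀ (hS z hz)).mp h

/-- If `Mᵀ + M` is positive definite, then `1 - t M` is a strict contraction for all small
`t > 0`. -/
lemma exists_forall_one_sub_smul_gram_sub_one_neg {n : Type*} [Fintype n] [DecidableEq n]
    (M : Matrix n n ℝ) (hM : ∀ z : n → ℝ, z ≠ 0 → 0 < z ⬝ᵥ ((Mᵀ + M) *ᵥ z)) :
    ∃ t₀ : ℝ, 0 < t₀ ∧ ∀ t : ℝ, 0 < t → t ≤ t₀ → ∀ z : n → ℝ, z ≠ 0 →
      z ⬝ᵥ (((1 - t • M)ᵀ * (1 - t • M) - 1) *ᵥ z) < 0 := by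
  obtain ⟨C, hC, hbound⟩ := exists_dotProduct_self_mulVec_le M (Mᵀ + M) hM
  refine ⟨1 / (C + 1), by positivity, fun t ht ht₀ z hz => ?_⟩
  rw [dotProduct_one_sub_smul_gram_sub_one]
  refine mul_neg_of_pos_of_neg ht (sub_neg.mpr ?_)
  have htC : t * C < 1 := by
    rw [le_div_iff₀ (by positivity)] at ht₀
    linarith
  calc t * ((M *ᵥ z) ⬝ᵥ (M *ᵥ z)) ≤ t * (C * (z ⬝ᵥ ((Mᵀ + M) *ᵥ z))) :=
        mul_le_mul_of_nonneg_left (hbound z) ht.le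
    _ = t * C * (z ⬝ᵥ ((Mᵀ + M) *ᵥ z)) := by ring
    _ < z ⬝ᵥ ((Mᵀ + M) *ᵥ z) := mul_lt_of_lt_one_left (hM z hz) htC

/-- Theorem 2 of the paper: if `K` satisfies the continuous-time stability LMI at
resistance `R₁`, then for every increased resistance `R₂ ≥ R₁` and all sufficiently
small discretization steps `Δt`, the forward-Euler closed-loop matrix `A - B K` with
`A = I - Δt • Â(R₂)` and `B = Δt • B̂` satisfies `(A - B K)ᵀ (A - B K) - I ≺ 0`. -/
theorem stabilizing_for_increased_resistance
    (L E ω : ℝ) (hL : 0 < L) (K : Matrix (Fin 2) (Fin 2) ℝ)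
    (Ahat : ℝ → Matrix (Fin 2) (Fin 2) ℝ)
    (hAhat : ∀ R : ℝ, Ahat R = !![R / L, ω; -ω, R / L])
    (Bhat : Matrix (Fin 2) (Fin 2) ℝ)
    (hBhat : Bhat = !![Real.sqrt 2 / L, 0; 0, Real.sqrt 2 * E / L])
    (R₁ : ℝ)
    (h₁ : ∀ z : Fin 2 → ℝ, z ≠ 0 →
      0 < z ⬝ᵥ (((Ahat R₁)ᵀ + Kᵀ * Bhatᵀ + Ahat R₁ + Bhat * K).mulVec z)) :
    ∀ R₂ : ℝ, R₁ ≤ R₂ → ∃ Δt₀ : ℝ, 0 < Δt₀ ∧ ∀ Δt : ℝ, 0 < Δt → Δt ≤ Δt₀ →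
      ∀ z : Fin 2 → ℝ, z ≠ 0 →
        z ⬝ᵥ (((((1 : Matrix (Fin 2) (Fin 2) ℝ) - Δt • Ahat R₂) - (Δt • Bhat) * K)ᵀ *
          (((1 : Matrix (Fin 2) (Fin 2) ℝ) - Δt • Ahat R₂) - (Δt • Bhat) * K) -
            1).mulVec z) < 0 := by
  intro R₂ hR
  have hpos : ∀ z : Fin 2 → ℝ, z ≠ 0 →
      0 < z ⬝ᵥ (((Ahat R₂ + Bhat * K)ᵀ + (Ahat R₂ + Bhat * K)) *ᵥ z) := by
    intro z hz
    have hshift : Ahat R₂ = Ahat R₁ + ((R₂ - R₁) / L) • (1 : Matrix (Fin 2) (Fin 2) ℝ) := by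
      rw [hAhat, hAhat]
      ext i j
      fin_cases i <;> fin_cases j <;> simp <;> ring
    have hsum : (Ahat R₂ + Bhat * K)ᵀ + (Ahat R₂ + Bhat * K) =
        ((Ahat R₁)ᵀ + Kᵀ * Bhatᵀ + Ahat R₁ + Bhat * K) +
          (2 * ((R₂ - R₁) / L)) • (1 : Matrix (Fin 2) (Fin 2) ℝ) := by
      rw [hshift, two_mul, add_smul]
      simp only [Matrix.transpose_add, Matrix.transpose_mul, Matrix.transpose_smul,
        Matrix.transpose_one]
      abel
    rw [hsum, Matrix.add_mulVec, dotProduct_add, Matrix.smul_mulVec, Matrix.one_mulVec,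
      dotProduct_smul, smul_eq_mul]
    have hc : 0 ≤ (R₂ - R₁) / L := div_nonneg (sub_nonneg.mpr hR) hL.le
    have hzz : 0 ≤ z ⬝ᵥ z := Finset.sum_nonneg fun i _ => mul_self_nonneg (z i)
    exact add_pos_of_pos_of_nonneg (h₁ z hz) (by positivity)
  obtain ⟨t₀, ht₀, h⟩ := exists_forall_one_sub_smul_gram_sub_one_neg _ hpos
  refine ⟨t₀, ht₀, fun t ht htt₀ z hz => ?_⟩
  rw [Matrix.smul_mul, sub_sub, ← smul_add]
  exact h t ht htt₀ z hz
end
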